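/- Fix σ ∈ ℝ and β > 0. Every positive first eigenfunction w of the one-dimensional Hermite–Robin problem −w'' + t w' = λ₁(σ) w on I_σ = (−∞,σ), w'(σ) + β w(σ) = 0, with w ∈ H¹(I_σ,φ₁), is strictly log-concave: the function f(t) = log w(t) satisfies f''(t) < 0 for all t ∈ I_σ. -/

import Mathlib

open MeasureTheory Real Set Filter Topology
open scoped RealInnerProductSpace NNReal ENNReal

noncomputable section

/-- The density `φ_N` of the standard Gaussian measure on `ℝ^N`. -/
def gaussDensity (N : ℕ) (x : EuclideanSpace ℝ (Fin N)) : ℝ :=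
  (2 * π) ^ (-(N : ℝ) / 2) * Real.exp (-‖x‖ ^ 2 / 2)

/-- The Gaussian measure `γ_N(A) = ∫_A φ_N dx`. -/
def gaussVol (N : ℕ) (A : Set (EuclideanSpace ℝ (Fin N))) : ℝ :=
  ∫ x in A, gaussDensity N x

/-- The `(N-1)`-dimensional Hausdorff measure on `ℝ^N`. -/
def hsurf (N : ℕ) : Measure (EuclideanSpace ℝ (Fin N)) :=
  Measure.hausdorffMeasure ((N : ℝ) - 1)

/-- Membership in the weighted Sobolev space `H¹(Ω, φ_N)`:
`u` is differentiable in `Ω` and both `u` and `|∇u|` belong to `L²(Ω, φ_N)`. -/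
def MemH1 (N : ℕ) (Ω : Set (EuclideanSpace ℝ (Fin N))) (u : EuclideanSpace ℝ (Fin N) → ℝ) : Prop :=
  (∀ x ∈ Ω, DifferentiableAt ℝ u x) ∧
    IntegrableOn (fun x => (u x) ^ 2 * gaussDensity N x) Ω volume ∧
    IntegrableOn (fun x => ‖gradient u x‖ ^ 2 * gaussDensity N x) Ω volume

/-- The Rayleigh quotient `J[β, v]` for the Robin problem for the Hermite operator. -/
def rayleighQuot (N : ℕ) (Ω : Set (EuclideanSpace ℝ (Fin N))) (β : ℝ)
    (v : EuclideanSpace ℝ (Fin N) → ℝ) : ℝ :=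
  ((∫ x in Ω, ‖gradient v x‖ ^ 2 * gaussDensity N x) +
      β * ∫ x in frontier Ω, (v x) ^ 2 * gaussDensity N x ∂(hsurf N)) /
    ∫ x in Ω, (v x) ^ 2 * gaussDensity N x

/-- The first Robin eigenvalue `λ₁(Ω)`, defined as the infimum of the Rayleigh quotient
over nonzero elements of `H¹(Ω, φ_N)`. -/
def lambda1 (N : ℕ) (Ω : Set (EuclideanSpace ℝ (Fin N))) (β : ℝ) : ℝ :=
  sInf (rayleighQuot N Ω β ''
    {v | MemH1 N Ω v ∧ 0 < ∫ x in Ω, (v x) ^ 2 * gaussDensity N x})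

/-- `Ω` is a Lipschitz domain: it is open, connected, and near every boundary point,
in a suitable direction `v`, `Ω` is the subgraph of a Lipschitz function. -/
def IsLipschitzDomain (N : ℕ) (Ω : Set (EuclideanSpace ℝ (Fin N))) : Prop :=
  IsOpen Ω ∧ IsConnected Ω ∧
    ∀ x ∈ frontier Ω, ∃ U : Set (EuclideanSpace ℝ (Fin N)), x ∈ U ∧ IsOpen U ∧
      ∃ (v : EuclideanSpace ℝ (Fin N)) (f : EuclideanSpace ℝ (Fin N) → ℝ) (K : ℝ≥0),
        ‖v‖ = 1 ∧ LipschitzWith K f ∧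
        Ω ∩ U = {y ∈ U | ⟪y, v⟫ < f (y - ⟪y, v⟫ • v)}

/-- `H¹(Ω, φ_N)` is compactly embedded in `L²(Ω, φ_N)`: every sequence bounded in the
`H¹(Ω,φ_N)` norm has a subsequence converging in `L²(Ω, φ_N)`. -/
def H1CompactlyEmbeddedInL2 (N : ℕ) (Ω : Set (EuclideanSpace ℝ (Fin N))) : Prop :=
  ∀ u : ℕ → EuclideanSpace ℝ (Fin N) → ℝ, (∀ n, MemH1 N Ω (u n)) →
    (∃ C : ℝ, ∀ n,
      (∫ x in Ω, (u n x) ^ 2 * gaussDensity N x) +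
        (∫ x in Ω, ‖gradient (u n) x‖ ^ 2 * gaussDensity N x) ≤ C) →
    ∃ (g : ℕ → ℕ) (v : EuclideanSpace ℝ (Fin N) → ℝ), StrictMono g ∧
      Tendsto (fun k => ∫ x in Ω, (u (g k) x - v x) ^ 2 * gaussDensity N x) atTop (𝓝 0)

/-- The trace operator `H¹(Ω,φ_N) → L²(∂Ω, φ_N)` is well defined. -/
def TraceWellDefined (N : ℕ) (Ω : Set (EuclideanSpace ℝ (Fin N))) : Prop :=
  ∀ u, MemH1 N Ω u →
    IntegrableOn (fun x => (u x) ^ 2 * gaussDensity N x) (frontier Ω) (hsurf N)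

/-- The trace operator `H¹(Ω,φ_N) → L²(∂Ω, φ_N)` is compact. -/
def TraceCompact (N : ℕ) (Ω : Set (EuclideanSpace ℝ (Fin N))) : Prop :=
  ∀ u : ℕ → EuclideanSpace ℝ (Fin N) → ℝ, (∀ n, MemH1 N Ω (u n)) →
    (∃ C : ℝ, ∀ n,
      (∫ x in Ω, (u n x) ^ 2 * gaussDensity N x) +
        (∫ x in Ω, ‖gradient (u n) x‖ ^ 2 * gaussDensity N x) ≤ C) →
    ∃ (g : ℕ → ℕ) (v : EuclideanSpace ℝ (Fin N) → ℝ), StrictMono g ∧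
      Tendsto (fun k => ∫ x in frontier Ω, (u (g k) x - v x) ^ 2 * gaussDensity N x ∂(hsurf N))
        atTop (𝓝 0)

/-- The class `𝒢` of admissible domains: Lipschitz domains with Gaussian measure in `(0,1)`
such that `H¹(Ω,φ_N)` is compactly embedded in `L²(Ω, φ_N)` and the trace operator into
`L²(∂Ω, φ_N)` is well defined and compact. -/
def GoodDomain (N : ℕ) (Ω : Set (EuclideanSpace ℝ (Fin N))) : Prop :=
  IsLipschitzDomain N Ω ∧ gaussVol N Ω ∈ Ioo (0 : ℝ) 1 ∧
    H1CompactlyEmbeddedInL2 N Ω ∧ TraceWellDefined N Ω ∧ TraceCompact N Ω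

/-- The half-space `S_a = {x ∈ ℝ^N : x₁ < a}`. -/
def halfSpace (N : ℕ) (hN : 0 < N) (a : ℝ) : Set (EuclideanSpace ℝ (Fin N)) :=
  {x | x ⟨0, hN⟩ < a}

/-- `u` is a (weak) eigenfunction of the Robin problem for the Hermite operator with
eigenvalue `lam`. -/
def IsEigenpair (N : ℕ) (Ω : Set (EuclideanSpace ℝ (Fin N))) (β lam : ℝ)
    (u : EuclideanSpace ℝ (Fin N) → ℝ) : Prop :=
  MemH1 N Ω u ∧ (0 < ∫ x in Ω, (u x) ^ 2 * gaussDensity N x) ∧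
    ∀ ψ, MemH1 N Ω ψ →
      (∫ x in Ω, ⟪gradient u x, gradient ψ x⟫ * gaussDensity N x) +
          β * (∫ x in frontier Ω, u x * ψ x * gaussDensity N x ∂(hsurf N)) =
        lam * ∫ x in Ω, u x * ψ x * gaussDensity N x

/-! ### One-dimensional objects -/

/-- Membership in the one-dimensional weighted Sobolev space `H¹(I_σ, φ₁)`. -/
def MemH1D (σ : ℝ) (v : ℝ → ℝ) : Prop :=
  ContinuousOn v (Iic σ) ∧ (∀ t ∈ Iio σ, DifferentiableAt ℝ v t) ∧
    IntegrableOn (fun t => (v t) ^ 2 * Real.exp (-t ^ 2 / 2)) (Iio σ) volume ∧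
    IntegrableOn (fun t => (deriv v t) ^ 2 * Real.exp (-t ^ 2 / 2)) (Iio σ) volume

/-- The one-dimensional Rayleigh quotient. -/
def rayleighQuot1D (σ β : ℝ) (v : ℝ → ℝ) : ℝ :=
  ((∫ t in Iio σ, (deriv v t) ^ 2 * Real.exp (-t ^ 2 / 2)) +
      β * (v σ) ^ 2 * Real.exp (-σ ^ 2 / 2)) /
    ∫ t in Iio σ, (v t) ^ 2 * Real.exp (-t ^ 2 / 2)

/-- The first eigenvalue `λ₁(σ)` of the one-dimensional Hermite–Robin problem on
`I_σ = (-∞, σ)`. -/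
def lambda1D (σ β : ℝ) : ℝ :=
  sInf (rayleighQuot1D σ β ''
    {v | MemH1D σ v ∧ 0 < ∫ t in Iio σ, (v t) ^ 2 * Real.exp (-t ^ 2 / 2)})

/-- `w` is a positive first eigenfunction of the one-dimensional Hermite–Robin problem
`-w'' + t w' = λ₁(σ) w` on `I_σ`, `w'(σ) + β w(σ) = 0`. -/
def Is1DFirstEigenfunction (σ β : ℝ) (w : ℝ → ℝ) : Prop :=
  MemH1D σ w ∧ (∀ t ∈ Iio σ, 0 < w t) ∧
    (∀ t ∈ Iio σ, -(deriv (deriv w) t) + t * deriv w t = lambda1D σ β * w t) ∧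
    deriv w σ + β * w σ = 0

/-! ### Level sets and the Bossel functional -/

/-- The super-level set `U_t = {x ∈ Ω : u(x) > t}`. -/
def superLevel (N : ℕ) (Ω : Set (EuclideanSpace ℝ (Fin N)))
    (u : EuclideanSpace ℝ (Fin N) → ℝ) (t : ℝ) : Set (EuclideanSpace ℝ (Fin N)) :=
  {x ∈ Ω | t < u x}

/-- The functional `F_Ω(U_t, ψ)`. -/
def Ffun (N : ℕ) (Ω : Set (EuclideanSpace ℝ (Fin N))) (β : ℝ)
    (u : EuclideanSpace ℝ (Fin N) → ℝ) (t : ℝ) (ψ : EuclideanSpace ℝ (Fin N) → ℝ) : ℝ :=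
  (gaussVol N (superLevel N Ω u t))⁻¹ *
    (-(∫ x in superLevel N Ω u t, (ψ x) ^ 2 * gaussDensity N x) +
      (∫ x in {x ∈ Ω | u x = t}, ψ x * gaussDensity N x ∂(hsurf N)) +
      β * (∫ x in {x ∈ frontier Ω | t < u x}, gaussDensity N x ∂(hsurf N)))

lemma exists_primitive_of_continuousOn_Iio {σ : ℝ} {g : ℝ → ℝ} (hg : ContinuousOn g (Iio σ)) :
    ∃ G : ℝ → ℝ, ∀ t < σ, HasDerivAt G (g t) t := by
  refine ⟨fun t => ∫ x in (σ - 1)..t, g x, fun t ht => ?_⟩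
  have hsub : uIcc (σ - 1) t ⊆ Iio σ := fun x hx => hx.2.trans_lt (max_lt (by linarith) ht)
  exact intervalIntegral.integral_hasDerivAt_right (hg.mono hsub).intervalIntegrable
    (hg.stronglyMeasurableAtFilter isOpen_Iio t ht) (hg.continuousAt (Iio_mem_nhds ht))

/-- A Darboux-type constancy criterion: a derivative that has zero derivative away from
countably many of its values is constant. -/
lemma eq_of_hasDerivAt_zero_off_countable {σ : ℝ} {H h : ℝ → ℝ} {E : Set ℝ} (hE : E.Countable)
    (hH : ∀ t < σ, HasDerivAt H (h t) t) (hh : ∀ t < σ, h t ∉ E → HasDerivAt h 0 t)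
    {a b : ℝ} (ha : a < σ) (hb : b < σ) : h a = h b := by
  have key : ∀ a < σ, ∀ b < σ, ¬ h a < h b := by
    intro a ha b hb hab
    have hoc : OrdConnected (h '' Iio σ) :=
      ordConnected_Iio.image_hasDerivWithinAt fun x hx => (hH x hx).hasDerivWithinAt
    have hnull : volume (h '' {t | HasDerivAt h 0 t}) = 0 :=
      addHaar_image_eq_zero_of_det_fderivWithin_eq_zero volume
        (f' := fun _ => ContinuousLinearMap.toSpanSingleton ℝ (0 : ℝ))
        (fun x hx => (HasDerivAt.hasFDerivAt hx).hasFDerivWithinAt)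
        (fun x _ => by simp [ContinuousLinearMap.det])
    have hsub : Ioo (h a) (h b) ⊆ h '' {t | HasDerivAt h 0 t} ∪ E := by
      intro y hy
      obtain ⟨t, ht, rfl⟩ := hoc.out ⟨a, ha, rfl⟩ ⟨b, hb, rfl⟩ (Ioo_subset_Icc_self hy)
      by_cases htE : h t ∈ E
      · exact Or.inr htE
      · exact Or.inl ⟨t, hh t ht htE, rfl⟩
    have h0 : volume (Ioo (h a) (h b)) = 0 :=
      measure_mono_null hsub (measure_union_null hnull (hE.measure_zero volume))
    rw [Real.volume_Ioo, ENNReal.ofReal_eq_zero] at h0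
    linarith
  exact le_antisymm (not_lt.1 (key b hb a ha)) (not_lt.1 (key a ha b hb))

/-- A derivative `u = U'` cannot cross a level `κ` downwards if it is strictly increasing
at each point of that level. -/
lemma not_downcrossing_of_deriv_pos {U u : ℝ → ℝ} {a b κ : ℝ} (hab : a < b)
    (hU : ∀ t ∈ Icc a b, HasDerivAt U (u t) t)
    (hu : ∀ t ∈ Ioo a b, u t = κ → ∃ d > 0, HasDerivAt u d t) (ha : κ < u a) (hb : u b < κ) :
    False := by
  set g : ℝ → ℝ := fun x => U x - κ * x
  have hg : ∀ x ∈ Icc a b, HasDerivAt g (u x - κ) x := fun x hx => by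
    simpa using! (hU x hx).sub ((hasDerivAt_id x).const_mul κ)
  obtain ⟨c, cmem, hc⟩ : ∃ c ∈ Icc a b, IsMaxOn g (Icc a b) c :=
    isCompact_Icc.exists_isMaxOn (nonempty_Icc.2 hab.le)
      fun x hx => (hg x hx).continuousAt.continuousWithinAt
  have hca : c ≠ a := by
    rintro rfl
    have := hc.localize.hasFDerivWithinAt_nonpos (hg c cmem).hasDerivWithinAt
      (sub_mem_posTangentConeAt_of_segment_subset (y := b) (by rw [segment_eq_Icc hab.le]))
    simp at this
    nlinarith
  have hcb : c ≠ b := by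
    rintro rfl
    have := hc.localize.hasFDerivWithinAt_nonpos (hg c cmem).hasDerivWithinAt
      (sub_mem_posTangentConeAt_of_segment_subset (y := a) (by
        rw [segment_symm, segment_eq_Icc hab.le]))
    simp at this
    nlinarith
  have hcI : c ∈ Ioo a b := ⟨lt_of_le_of_ne cmem.1 hca.symm, lt_of_le_of_ne cmem.2 hcb⟩
  have hnhds : Icc a b ∈ 𝓝 c := Icc_mem_nhds hcI.1 hcI.2
  have hmax : IsLocalMax g c := hc.isLocalMax hnhds
  have hgc : u c - κ = 0 := hmax.hasDerivAt_eq_zero (hg c cmem)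
  obtain ⟨d, hd, hud⟩ := hu c hcI (by linarith)
  have hder : deriv g =ᶠ[𝓝 c] fun x => u x - κ := by
    filter_upwards [hnhds] with x hx using (hg x hx).deriv
  have hdd : deriv (deriv g) c = d := by
    rw [hder.deriv_eq]; exact (hud.sub_const κ).deriv
  have hmin : IsLocalMin g c := isLocalMin_of_deriv_deriv_pos (by rw [hdd]; exact hd)
    (by rw [(hg c cmem).deriv, hgc]) (hg c cmem).continuousAt
  have hconst : g =ᶠ[𝓝 c] fun _ => g c := by
    filter_upwards [hmax, hmin] with x h1 h2 using le_antisymm h1 h2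
  have : deriv (deriv g) c = 0 := by
    rw [hconst.deriv.deriv_eq]; simp
  linarith

/-- A derivative that is strictly increasing at each of its points of small nonzero value is
continuous at its zeros and has connected zero set. -/
lemma continuousAt_zero_of_deriv_pos {U u : ℝ → ℝ} {x r δ : ℝ} (hr : 0 < r) (hδ : 0 < δ)
    (hU : ∀ t ∈ Ioo (x - r) (x + r), HasDerivAt U (u t) t)
    (hu : ∀ t ∈ Ioo (x - r) (x + r), u t ≠ 0 → |u t| < δ → ∃ d > 0, HasDerivAt u d t)
    (hx : u x = 0) :
    ContinuousAt u x ∧ ∀ y ∈ Ioo (x - r) (x + r), u y = 0 → ∀ z ∈ uIcc x y, u z = 0 := by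
  have hxm : x ∈ Ioo (x - r) (x + r) := ⟨by linarith, by linarith⟩
  have nocross : ∀ a ∈ Ioo (x - r) (x + r), ∀ b ∈ Ioo (x - r) (x + r), a < b → ∀ κ, κ ≠ 0 →
      |κ| < δ → κ < u a → ¬ u b < κ := by
    intro a ha b hb hab κ hκ hκδ h1 h2
    have hsub : Icc a b ⊆ Ioo (x - r) (x + r) := fun t ht =>
      ⟨ha.1.trans_le ht.1, ht.2.trans_lt hb.2⟩
    refine not_downcrossing_of_deriv_pos hab (fun t ht => hU t (hsub ht))
      (fun t ht htκ => hu t (hsub (Ioo_subset_Icc_self ht)) (htκ ▸ hκ) (htκ ▸ hκδ)) h1 h2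
  have hright : ∀ y ∈ Ioo (x - r) (x + r), x < y → 0 ≤ u y := by
    intro y hy hxy
    by_contra! hneg
    have : max (u y / 2) (-δ / 2) < 0 := max_lt (by linarith) (by linarith)
    exact nocross x hxm y hy hxy (max (u y / 2) (-δ / 2)) this.ne
      (by rw [abs_of_neg this]; linarith [le_max_right (u y / 2) (-δ / 2)])
      (by rw [hx]; exact this) (lt_of_lt_of_le (by linarith) (le_max_left _ _))
  have hleft : ∀ y ∈ Ioo (x - r) (x + r), y < x → u y ≤ 0 := by
    intro y hy hxy
    by_contra! hpos
    have : 0 < min (u y / 2) (δ / 2) := lt_min (by linarith) (by linarith)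
    exact nocross y hy x hxm hxy (min (u y / 2) (δ / 2)) this.ne'
      (by rw [abs_of_pos this]; linarith [min_le_right (u y / 2) (δ / 2)])
      (lt_of_le_of_lt (min_le_left _ _) (by linarith)) (by rw [hx]; exact this)
  refine ⟨?_, ?_⟩
  · rw [Metric.continuousAt_iff']
    intro ε hε
    set e := min ε δ / 2
    have he : 0 < e := half_pos (lt_min hε hδ)
    have heε : e < ε := by
      have := min_le_left ε δ
      have : e * 2 = min ε δ := by simp [e]
      linarith
    have heδ : e < δ := by
      have := min_le_right ε δ
      have : e * 2 = min ε δ := by simp [e]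
      linarith
    have hR : ∃ y ∈ Ioo (x - r) (x + r), x < y ∧ u y < e := by
      by_contra! hcon
      have hy : x + r / 2 ∈ Ioo (x - r) (x + r) := ⟨by linarith, by linarith⟩
      have hxy : x < x + r / 2 := by linarith
      obtain ⟨z, hz, hze⟩ := exists_hasDerivWithinAt_eq_of_gt_of_lt hxy.le (f := U) (f' := u)
        (fun t ht => (hU t ⟨by linarith [ht.1], by linarith [ht.2]⟩).hasDerivWithinAt)
        (m := e / 2) (by rw [hx]; linarith) (by linarith [hcon _ hy hxy])
      linarith [hcon z ⟨by linarith [hz.1], by linarith [hz.2]⟩ hz.1]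
    have hL : ∃ y ∈ Ioo (x - r) (x + r), y < x ∧ -e < u y := by
      by_contra! hcon
      have hy : x - r / 2 ∈ Ioo (x - r) (x + r) := ⟨by linarith, by linarith⟩
      have hxy : x - r / 2 < x := by linarith
      obtain ⟨z, hz, hze⟩ := exists_hasDerivWithinAt_eq_of_gt_of_lt hxy.le (f := U) (f' := u)
        (fun t ht => (hU t ⟨by linarith [ht.1], by linarith [ht.2]⟩).hasDerivWithinAt)
        (m := -e / 2) (by linarith [hcon _ hy hxy]) (by rw [hx]; linarith)
      linarith [hcon z ⟨by linarith [hz.1], by linarith [hz.2]⟩ hz.2]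
    obtain ⟨b, hb, hxb, hbe⟩ := hR
    obtain ⟨a, ha, hax, hae⟩ := hL
    filter_upwards [Ioo_mem_nhds hax hxb] with z hz
    have hzm : z ∈ Ioo (x - r) (x + r) := ⟨ha.1.trans hz.1, hz.2.trans hb.2⟩
    rw [hx, Real.dist_eq, sub_zero, abs_lt]
    have h1 : u z ≤ e := not_lt.1 fun hlt => nocross z hzm b hb hz.2 e he.ne'
      (by rwa [abs_of_pos he]) hlt hbe
    have h2 : -e ≤ u z := not_lt.1 fun hlt => nocross a ha z hzm hz.1 (-e) (by linarith)
      (by rwa [abs_neg, abs_of_pos he]) hae hlt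
    exact ⟨by linarith, by linarith⟩
  · intro y hy hy0 z hz
    rcases lt_trichotomy z x with hzx | rfl | hxz
    · have hyz : y ≤ z := by
        rcases le_total x y with h | h
        · rw [uIcc_of_le h] at hz; linarith [hz.1]
        · rw [uIcc_of_ge h] at hz; exact hz.1
      rcases hyz.eq_or_lt with rfl | hyz
      · exact hy0
      have hzm : z ∈ Ioo (x - r) (x + r) := ⟨hy.1.trans hyz, hzx.trans hxm.2⟩
      refine le_antisymm (hleft z hzm hzx) ?_
      by_contra! hneg
      have : max (u z / 2) (-δ / 2) < 0 := max_lt (by linarith) (by linarith)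
      exact nocross y hy z hzm hyz (max (u z / 2) (-δ / 2)) this.ne
        (by rw [abs_of_neg this]; linarith [le_max_right (u z / 2) (-δ / 2)])
        (by rw [hy0]; exact this) (lt_of_lt_of_le (by linarith) (le_max_left _ _))
    · exact hx
    · have hzy : z ≤ y := by
        rcases le_total x y with h | h
        · rw [uIcc_of_le h] at hz; exact hz.2
        · rw [uIcc_of_ge h] at hz; linarith [hz.2]
      rcases hzy.eq_or_lt with rfl | hzy
      · exact hy0
      have hzm : z ∈ Ioo (x - r) (x + r) := ⟨hxm.1.trans hxz, hzy.trans hy.2⟩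
      refine le_antisymm ?_ (hright z hzm hxz)
      by_contra! hpos
      have : 0 < min (u z / 2) (δ / 2) := lt_min (by linarith) (by linarith)
      exact nocross z hzm y hy hzy (min (u z / 2) (δ / 2)) this.ne'
        (by rw [abs_of_pos this]; linarith [min_le_right (u z / 2) (δ / 2)])
        (lt_of_le_of_lt (min_le_left _ _) (by linarith)) (by rw [hy0]; exact this)

/-- If `w' = v` on `(-∞, σ)`, any combination `a v + b w` with `a` of class `C¹` and `b`
continuous is again a derivative there. -/
lemma exists_primitive_mul_deriv_add_mul {σ : ℝ} {w v a a' b : ℝ → ℝ}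
    (hw : ∀ t < σ, HasDerivAt w (v t) t) (ha : ∀ t, HasDerivAt a (a' t) t)
    (ha' : Continuous a') (hb : Continuous b) :
    ∃ U : ℝ → ℝ, ∀ t < σ, HasDerivAt U (a t * v t + b t * w t) t := by
  have hwc : ContinuousOn w (Iio σ) := fun t ht => (hw t ht).continuousAt.continuousWithinAt
  obtain ⟨G, hG⟩ := exists_primitive_of_continuousOn_Iio
    ((hb.sub ha').continuousOn.mul hwc : ContinuousOn (fun t => (b t - a' t) * w t) (Iio σ))
  refine ⟨fun t => a t * w t + G t, fun t ht => ?_⟩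
  convert! ((ha t).mul (hw t ht)).add (hG t ht) using 1
  simp only [Pi.mul_apply, Pi.sub_apply]
  ring

lemma hasDerivAt_exp_neg_sq_div_two (t : ℝ) :
    HasDerivAt (fun t : ℝ => Real.exp (-t ^ 2 / 2)) (-t * Real.exp (-t ^ 2 / 2)) t := by
  have h : HasDerivAt (fun t : ℝ => -t ^ 2 / 2) (-t) t := by
    convert! ((hasDerivAt_pow 2 t).neg.div_const 2) using 1
    simp
    ring
  convert! h.exp using 1
  ring

/-- If the derivative `v` of a positive function `w` satisfies the Hermite equation with `deriv v`
as a (possibly junk) second derivative, then `v` is genuinely differentiable. -/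
lemma hasDerivAt_of_deriv_eq_hermite {σ l : ℝ} {w v : ℝ → ℝ} (hl : 0 ≤ l)
    (hw : ∀ t < σ, HasDerivAt w (v t) t) (hpos : ∀ t < σ, 0 < w t)
    (hv : ∀ t < σ, deriv v t = t * v t - l * w t) {x : ℝ} (hx : x < σ) :
    HasDerivAt v (x * v x - l * w x) x := by
  set u : ℝ → ℝ := fun t => t * v t - l * w t with hu
  have hO : ∀ t < σ, u t ≠ 0 → HasDerivAt v (u t) t := fun t ht hne => by
    have h := hv t ht
    rw [show u t = deriv v t from h.symm] at hne ⊢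
    exact (differentiableAt_of_deriv_ne_zero hne).hasDerivAt
  have hOu : ∀ t < σ, u t ≠ 0 → HasDerivAt u (v t + t * u t - l * v t) t := fun t ht hne => by
    convert! ((hasDerivAt_id t).mul (hO t ht hne)).sub ((hw t ht).const_mul l) using 1
    simp
  by_cases hux : u x ≠ 0
  · exact hO x hx hux
  rw [not_not] at hux
  -- It suffices that `v` is differentiable at `x`.
  suffices hd : DifferentiableAt ℝ v x by
    have := hd.hasDerivAt
    rwa [hv x hx] at this
  rcases hl.eq_or_lt with rfl | hl
  · -- `v φ` is constant
    obtain ⟨P, hP⟩ := exists_primitive_mul_deriv_add_mul (b := 0) hw hasDerivAt_exp_neg_sq_div_two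
      (by fun_prop) continuous_zero
    set p : ℝ → ℝ := fun t => Real.exp (-t ^ 2 / 2) * v t with hp
    have hconst : ∀ t < σ, p t = p x := fun t ht =>
      eq_of_hasDerivAt_zero_off_countable (E := {0, p 0}) (by simp)
        (H := P) (h := p) (fun t ht => by simpa [hp] using hP t ht)
        (fun t ht htE => by
          simp only [mem_insert_iff, mem_singleton_iff, not_or] at htE
          have hvt : v t ≠ 0 := fun h => htE.1 (by simp [hp, h])
          have ht0 : t ≠ 0 := fun h => htE.2 (by rw [h])
          convert! (hasDerivAt_exp_neg_sq_div_two t).mul (hO t ht (by simp [hu, hvt, ht0])) using 1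
          simp [hu]
          ring) ht hx
    have hveq : v =ᶠ[𝓝 x] fun t => Real.exp (t ^ 2 / 2) * p x := by
      filter_upwards [Iio_mem_nhds hx] with t ht
      rw [← hconst t ht, hp]
      simp only
      rw [← mul_assoc, ← Real.exp_add]
      ring_nf
      simp
    exact DifferentiableAt.congr_of_eventuallyEq (by fun_prop) hveq
  have hx0 : x ≠ 0 := by
    rintro rfl
    have := hpos 0 hx
    simp [hu] at hux
    rcases hux with h | h <;> linarith
  have hzero : ∀ z < σ, (∀ᶠ t in 𝓝 z, u t = 0) → z ≠ 0 →
      HasDerivAt v (l * ((v z * z - w z) / z ^ 2)) z := fun z hz hev hz0 => by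
    have h1 : v =ᶠ[𝓝 z] fun t => l * (w t / t) := by
      filter_upwards [hev, isOpen_ne.mem_nhds hz0] with t ht ht0
      have : t * v t = l * w t := by simpa [hu, sub_eq_zero] using ht
      have ht0 : t ≠ 0 := ht0
      field_simp
      linarith
    refine HasDerivAt.congr_of_eventuallyEq ?_ h1
    convert! ((hw z hz).div (hasDerivAt_id z) hz0).const_mul l using 1
    simp
  by_cases hl1 : l = 1
  · subst hl1
    -- `u φ` is constant
    obtain ⟨P, hP⟩ := exists_primitive_mul_deriv_add_mul (a := fun t => t * Real.exp (-t ^ 2 / 2))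
      (b := fun t => - Real.exp (-t ^ 2 / 2)) hw
      (fun t => (hasDerivAt_id t).mul (hasDerivAt_exp_neg_sq_div_two t))
      (by fun_prop) (by fun_prop)
    set p : ℝ → ℝ := fun t => Real.exp (-t ^ 2 / 2) * u t with hp
    have hconst : ∀ t < σ, p t = p x := fun t ht =>
      eq_of_hasDerivAt_zero_off_countable (E := {0}) (by simp)
        (H := P) (h := p) (fun t ht => by
          convert! hP t ht using 1
          simp only [hp, hu]
          ring)
        (fun t ht htE => by
          have hut : u t ≠ 0 := fun h => htE (by simp [hp, h])
          convert! (hasDerivAt_exp_neg_sq_div_two t).mul (hOu t ht hut) using 1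
          ring) ht hx
    refine (hzero x hx ?_ hx0).differentiableAt
    filter_upwards [Iio_mem_nhds hx] with t ht
    have := hconst t ht
    simpa [hp, hux] using this
  -- the generic case
  obtain ⟨U, hU⟩ := exists_primitive_mul_deriv_add_mul (b := fun _ => -l) hw
    (hasDerivAt_id) (by fun_prop) (by fun_prop)
  have hU : ∀ t < σ, HasDerivAt U (u t) t := fun t ht => by
    convert! hU t ht using 1
    simp [hu]
    ring
  have hwx := hpos x hx
  obtain ⟨s, hs, hc⟩ : ∃ s : ℝ, s ≠ 0 ∧ 0 < s * ((1 - l) * (l * w x / x)) := by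
    have hne : (1 - l) * (l * w x / x) ≠ 0 := by
      have : 1 - l ≠ 0 := fun h => hl1 (by linarith)
      positivity
    exact ⟨_, hne, mul_self_pos.2 hne⟩
  have hcont : ContinuousAt
      (fun q : ℝ × ℝ => s * (q.1 * q.2 + (1 - l) * ((q.2 + l * w q.1) / q.1))) (x, 0) := by
    have hwq : ContinuousAt (fun q : ℝ × ℝ => w q.1) (x, 0) :=
      ContinuousAt.comp (f := Prod.fst) (x := ((x, 0) : ℝ × ℝ)) (hw x hx).continuousAt
        continuousAt_fst
    exact continuousAt_const.mul ((continuousAt_fst.mul continuousAt_snd).add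
      (continuousAt_const.mul ((continuousAt_snd.add (continuousAt_const.mul hwq)).div
        continuousAt_fst hx0)))
  have hev := hcont.eventually (lt_mem_nhds (show 0 < _ by simpa using hc))
  rw [nhds_prod_eq, eventually_prod_iff] at hev
  obtain ⟨pa, hpa, pb, hpb, hab⟩ := hev
  obtain ⟨r, hr, hrI⟩ := Metric.eventually_nhds_iff_ball.1
    (hpa.and ((eventually_lt_nhds hx).and (eventually_ne_nhds hx0)))
  obtain ⟨δ, hδ, hδI⟩ := Metric.eventually_nhds_iff_ball.1 hpb
  rw [Real.ball_eq_Ioo] at hrI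
  have hrσ : ∀ t ∈ Ioo (x - r) (x + r), t < σ := fun t ht => (hrI t ht).2.1
  have hr0 : ∀ t ∈ Ioo (x - r) (x + r), t ≠ 0 := fun t ht => (hrI t ht).2.2
  obtain ⟨hsc, hsz⟩ := continuousAt_zero_of_deriv_pos (U := fun t => s * U t)
    (u := fun t => s * u t) (x := x) (δ := |s| * δ) hr (by positivity)
    (fun t ht => (hU t (hrσ t ht)).const_mul s)
    (fun t ht hne hlt => by
      have hut : u t ≠ 0 := right_ne_zero_of_mul hne
      refine ⟨_, ?_, (hOu t (hrσ t ht) hut).const_mul s⟩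
      rw [abs_mul] at hlt
      have hlt : |u t| < δ := lt_of_mul_lt_mul_left hlt (abs_nonneg s)
      have h := hab (hrI t ht).1 (hδI (u t) (by simpa using hlt))
      simp only at h
      have hvt : (u t + l * w t) / t = v t := by
        have := hr0 t ht
        rw [div_eq_iff this]
        simp only [hu]
        ring
      rw [hvt] at h
      exact h.trans_eq (by ring)) (by simp [hux])
  have huc : ContinuousAt u x := by
    have := hsc.const_mul s⁻¹
    simpa [← mul_assoc, inv_mul_cancel₀ hs] using this
  have hvc : ContinuousAt v x := by
    have h1 : ContinuousAt (fun t => (u t + l * w t) / t) x :=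
      (huc.add (continuousAt_const.mul (hw x hx).continuousAt)).div continuousAt_id hx0
    refine h1.congr ?_
    filter_upwards [Ioo_mem_nhds (sub_lt_self x hr) (lt_add_of_pos_right x hr)] with t ht
    rw [div_eq_iff (hr0 t ht)]
    simp only [hu]
    ring
  have hune : ∀ y ∈ Ioo (x - r) (x + r), y ≠ x → u y ≠ 0 := by
    intro y hy hyx hy0
    have hxm : x ∈ Ioo (x - r) (x + r) := ⟨by linarith, by linarith⟩
    have hz : ∀ z ∈ uIcc x y, u z = 0 := fun z hz => by
      simpa [hs] using hsz y hy (by simp [hy0]) z hz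
    obtain ⟨z, hzI⟩ : (Ioo (min x y) (max x y)).Nonempty :=
      nonempty_Ioo.2 (min_lt_max.2 hyx.symm)
    have hzm : z ∈ Ioo (x - r) (x + r) :=
      ⟨(lt_min hxm.1 hy.1).trans hzI.1, hzI.2.trans (max_lt hxm.2 hy.2)⟩
    have hz0 := hr0 z hzm
    have hd := (hzero z (hrσ z hzm) (by
      filter_upwards [Ioo_mem_nhds hzI.1 hzI.2] with t ht
      exact hz t (Ioo_subset_Icc_self ht)) hz0).deriv
    have huz : u z = 0 := hz z (Ioo_subset_Icc_self hzI)
    rw [hv z (hrσ z hzm)] at hd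
    have h1 : v z * z - w z = 0 := by
      have : l * ((v z * z - w z) / z ^ 2) = 0 := by rw [← hd]; exact huz
      simpa [hl.ne', hz0] using this
    have h2 : (1 - l) * w z = 0 := by
      simp only [hu] at huz
      linarith
    rcases mul_eq_zero.1 h2 with h | h
    · exact hl1 (by linarith)
    · exact (hpos z (hrσ z hzm)).ne' h
  have hdiff : ∀ y ∈ Ioo (x - r) (x + r), y ≠ x → HasDerivAt v (u y) y := fun y hy hyx =>
    hO y (hrσ y hy) (hune y hy hyx)
  have hA : HasDerivWithinAt v (u x) (Ici x) x := by
    refine hasDerivWithinAt_Ici_of_tendsto_deriv (s := Ioo x (x + r)) (fun y hy =>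
      (hdiff y ⟨by linarith [hy.1], hy.2⟩ hy.1.ne').differentiableAt.differentiableWithinAt)
      hvc.continuousWithinAt (Ioo_mem_nhdsGT (by linarith)) ?_
    refine (huc.tendsto.mono_left nhdsWithin_le_nhds).congr' ?_
    filter_upwards [Ioo_mem_nhdsGT (show x < x + r by linarith)] with y hy
    exact (hdiff y ⟨by linarith [hy.1], hy.2⟩ hy.1.ne').deriv.symm
  have hB : HasDerivWithinAt v (u x) (Iic x) x := by
    refine hasDerivWithinAt_Iic_of_tendsto_deriv (s := Ioo (x - r) x) (fun y hy =>
      (hdiff y ⟨hy.1, by linarith [hy.2]⟩ hy.2.ne).differentiableAt.differentiableWithinAt)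
      hvc.continuousWithinAt (Ioo_mem_nhdsLT (by linarith)) ?_
    refine (huc.tendsto.mono_left nhdsWithin_le_nhds).congr' ?_
    filter_upwards [Ioo_mem_nhdsLT (show x - r < x by linarith)] with y hy
    exact (hdiff y ⟨hy.1, by linarith [hy.2]⟩ hy.2.ne).deriv.symm
  have := hB.union hA
  rw [Iic_union_Ici, hasDerivWithinAt_univ] at this
  exact this.differentiableAt

lemma lambda1D_nonneg {σ β : ℝ} (hβ : 0 ≤ β) : 0 ≤ lambda1D σ β := by
  refine Real.sInf_nonneg ?_
  rintro _ ⟨v, -, rfl⟩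
  refine div_nonneg (add_nonneg ?_ (by positivity)) ?_ <;>
  exact setIntegral_nonneg measurableSet_Iio fun t _ => by positivity

lemma integrableOn_mul_exp_of_sq {σ : ℝ} {f g : ℝ → ℝ} (hf : ContinuousOn f (Iio σ))
    (hg : ContinuousOn g (Iio σ))
    (hf2 : IntegrableOn (fun t => (f t) ^ 2 * Real.exp (-t ^ 2 / 2)) (Iio σ))
    (hg2 : IntegrableOn (fun t => (g t) ^ 2 * Real.exp (-t ^ 2 / 2)) (Iio σ)) :
    IntegrableOn (fun t => f t * g t * Real.exp (-t ^ 2 / 2)) (Iio σ) := by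
  refine Integrable.mono' (hf2.add hg2) ?_ ?_
  · exact ((hf.mul hg).mul (by fun_prop)).aestronglyMeasurable measurableSet_Iio
  · refine Eventually.of_forall fun t => ?_
    have := Real.exp_pos (-t ^ 2 / 2)
    simp only [Pi.add_apply, norm_mul, Real.norm_eq_abs, abs_of_pos this]
    rw [← add_mul]
    gcongr
    nlinarith [sq_abs (f t), sq_abs (g t), sq_nonneg (|f t| - |g t|)]

/-- A positive solution `w` of the Hermite equation with `l > 0`, whose derivative `v` satisfies
`v φ → 0` at `-∞` and `w v φ ∈ L¹`, makes
`w ^ 2 (log w)''` negative on its domain. -/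
lemma hermite_mul_deriv_deriv_sub_sq_neg {σ l : ℝ} {w v : ℝ → ℝ} (hl : 0 < l)
    (hw : ∀ t < σ, HasDerivAt w (v t) t) (hpos : ∀ t < σ, 0 < w t)
    (hv : ∀ t < σ, HasDerivAt v (t * v t - l * w t) t)
    (hvlim : Tendsto (fun t => v t * Real.exp (-t ^ 2 / 2)) atBot (𝓝 0))
    (hwv : IntegrableOn (fun t => w t * v t * Real.exp (-t ^ 2 / 2)) (Iio σ)) {x : ℝ} (hx : x < σ) :
    w x * (x * v x - l * w x) - v x ^ 2 < 0 := by
  have hp : ∀ t < σ, HasDerivAt (fun t => v t * Real.exp (-t ^ 2 / 2))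
      (-(l * w t * Real.exp (-t ^ 2 / 2))) t := fun t ht => by
    convert! (hv t ht).mul (hasDerivAt_exp_neg_sq_div_two t) using 1
    ring
  have hvneg : ∀ t < σ, v t < 0 := by
    have hanti : StrictAntiOn (fun t => v t * Real.exp (-t ^ 2 / 2)) (Iio σ) := by
      refine strictAntiOn_of_deriv_neg (convex_Iio σ)
        (fun t ht => (hp t ht).continuousAt.continuousWithinAt) fun t ht => ?_
      rw [interior_Iio] at ht
      rw [(hp t ht).deriv]
      have := hpos t ht
      have := Real.exp_pos (-t ^ 2 / 2)
      exact neg_neg_of_pos (by positivity)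
    intro t ht
    have h1 : t - 1 < σ := by linarith
    have hle : v (t - 1) * Real.exp (-(t - 1) ^ 2 / 2) ≤ 0 := by
      refine ge_of_tendsto hvlim ?_
      filter_upwards [Iic_mem_atBot (t - 1)] with s hs
      exact hanti.antitoneOn (lt_of_le_of_lt hs h1) h1 hs
    have hlt := hanti h1 ht (by linarith : t - 1 < t)
    exact neg_of_mul_neg_left (hlt.trans_le hle) (Real.exp_pos _).le
  set k : ℝ → ℝ := fun t => (w t * (t * v t - l * w t) - v t ^ 2) * Real.exp (-t ^ 2 / 2) with hk
  have hkd : ∀ t < σ, HasDerivAt k (w t * v t * Real.exp (-t ^ 2 / 2)) t := fun t ht => by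
    convert! (((hw t ht).mul (((hasDerivAt_id t).mul (hv t ht)).sub
      ((hw t ht).const_mul l))).sub ((hv t ht).pow 2)).mul (hasDerivAt_exp_neg_sq_div_two t) using 1
    simp
    ring
  have hkanti : StrictAntiOn k (Iio σ) := by
    refine strictAntiOn_of_deriv_neg (convex_Iio σ)
      (fun t ht => (hkd t ht).continuousAt.continuousWithinAt) fun t ht => ?_
    rw [interior_Iio] at ht
    rw [(hkd t ht).deriv]
    exact mul_neg_of_neg_of_pos (mul_neg_of_pos_of_neg (hpos t ht) (hvneg t ht)) (Real.exp_pos _)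
  by_contra! hcon
  have hkx : 0 ≤ k x := mul_nonneg hcon (Real.exp_pos _).le
  have hx1 : x - 1 < σ := by linarith
  have hc : 0 < k (x - 1) := hkx.trans_lt (hkanti hx1 hx (by linarith))
  set c := k (x - 1)
  refine not_integrableOn_of_tendsto_norm_atTop_of_deriv_isBigO_filter (f := Real.log) atBot
    (Iio_mem_atBot σ) ?_ ?_ ?_ hwv
  · filter_upwards [Iio_mem_atBot 0] with t ht using
      Real.differentiableAt_log (ne_of_lt ht)
  · have : Tendsto Real.log atBot atTop := by
      have := Real.tendsto_log_atTop.comp tendsto_neg_atBot_atTop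
      simpa [Function.comp_def] using this
    exact tendsto_norm_atTop_atTop.comp this
  · refine Asymptotics.IsBigO.of_bound c⁻¹ ?_
    filter_upwards [Iio_mem_atBot 0, Iic_mem_atBot (x - 1)] with t ht htx
    have ht : t < 0 := ht
    have htσ : t < σ := lt_of_le_of_lt htx hx1
    have hkt : c ≤ k t := hkanti.antitoneOn htσ hx1 htx
    have hE := Real.exp_pos (-t ^ 2 / 2)
    have hwt := hpos t htσ
    have hneg : w t * v t * Real.exp (-t ^ 2 / 2) < 0 :=
      mul_neg_of_neg_of_pos (mul_neg_of_pos_of_neg hwt (hvneg t htσ)) hE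
    rw [Real.deriv_log, Real.norm_eq_abs, Real.norm_eq_abs, abs_of_neg hneg,
      abs_of_neg (inv_lt_zero.2 ht), ← inv_neg, ← div_eq_inv_mul,
      inv_le_comm₀ (by linarith) (div_pos (by linarith) hc), inv_div, div_le_iff₀ (by linarith)]
    have h1 : 0 ≤ (l * w t ^ 2 + v t ^ 2) * Real.exp (-t ^ 2 / 2) := by positivity
    have h2 : k t = t * (w t * v t * Real.exp (-t ^ 2 / 2))
      - (l * w t ^ 2 + v t ^ 2) * Real.exp (-t ^ 2 / 2) := by
      simp only [hk]; ring
    linarith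

/-- **Log-concavity of the first eigenfunction.** Every positive first eigenfunction `w` of
the one-dimensional Hermite–Robin problem on `I_σ = (-∞,σ)` is strictly log-concave:
`(log w)'' < 0` on `I_σ`. -/
theorem first_eigenfunction_log_concave (σ β : ℝ) (hβ : 0 < β) (w : ℝ → ℝ)
    (hw : Is1DFirstEigenfunction σ β w) :
    ∀ t ∈ Iio σ, deriv (deriv fun s => Real.log (w s)) t < 0 := by
  obtain ⟨⟨hwc, hwd, hw2, hv2⟩, hpos, hode, hbc⟩ := hw
  have hpos : ∀ t < σ, 0 < w t := hpos
  have hw' : ∀ t < σ, HasDerivAt w (deriv w t) t := fun t ht => (hwd t ht).hasDerivAt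
  have hl0 : 0 ≤ lambda1D σ β := lambda1D_nonneg hβ.le
  set l := lambda1D σ β
  have hv : ∀ t < σ, HasDerivAt (deriv w) (t * deriv w t - l * w t) t := fun t ht =>
    hasDerivAt_of_deriv_eq_hermite hl0 hw' hpos (fun t ht => by linarith [hode t ht]) ht
  have hwcont : ContinuousOn w (Iio σ) := hwc.mono Iio_subset_Iic_self
  have hvcont : ContinuousOn (deriv w) (Iio σ) := fun t ht =>
    (hv t ht).continuousAt.continuousWithinAt
  have h1 : IntegrableOn (fun t => (1 : ℝ) ^ 2 * Real.exp (-t ^ 2 / 2)) (Iio σ) := by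
    have := (integrable_exp_neg_mul_sq (b := 1 / 2) (by norm_num)).integrableOn (s := Iio σ)
    convert this using 3
    ring_nf
  have hp : ∀ t < σ, HasDerivAt (fun t => deriv w t * Real.exp (-t ^ 2 / 2))
      (-l * (w t * Real.exp (-t ^ 2 / 2))) t := fun t ht => by
    convert! (hv t ht).mul (hasDerivAt_exp_neg_sq_div_two t) using 1
    ring
  have hw1 : IntegrableOn (fun t => w t * Real.exp (-t ^ 2 / 2)) (Iio σ) := by
    simpa using integrableOn_mul_exp_of_sq hwcont continuousOn_const hw2 h1
  have hv1 : IntegrableOn (fun t => deriv w t * Real.exp (-t ^ 2 / 2)) (Iio σ) := by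
    simpa using integrableOn_mul_exp_of_sq hvcont continuousOn_const hv2 h1
  have hsub : Iic (σ - 1) ⊆ Iio σ := Iic_subset_Iio.2 (by linarith)
  have hvlim : Tendsto (fun t => deriv w t * Real.exp (-t ^ 2 / 2)) atBot (𝓝 0) :=
    tendsto_zero_of_hasDerivAt_of_integrableOn_Iic (a := σ - 1) (fun t ht => hp t (hsub ht))
      ((hw1.mono_set hsub).const_mul (-l)) (hv1.mono_set hsub)
  have hl : 0 < l := by
    refine hl0.lt_of_ne fun hl => ?_
    have hv0 : ∀ t < σ, deriv w t = 0 := fun t ht => by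
      have hc : ∀ s ≤ t, deriv w s * Real.exp (-s ^ 2 / 2) = deriv w t * Real.exp (-t ^ 2 / 2) :=
        fun s hs => isOpen_Iio.is_const_of_deriv_eq_zero isPreconnected_Iio
          (fun r hr => (hp r hr).differentiableAt.differentiableWithinAt)
          (fun r hr => by simp [(hp r hr).deriv, ← hl]) (lt_of_le_of_lt hs ht) ht
      have h := tendsto_nhds_unique (hvlim.congr' (by
        filter_upwards [Iic_mem_atBot t] with s hs using hc s hs)) tendsto_const_nhds
      simpa using h.symm
    have hconst : ∀ t ∈ Iic σ, w t = w (σ - 1) := by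
      have h0 : EqOn w (fun _ => w (σ - 1)) (Iio σ) := fun t ht =>
        isOpen_Iio.is_const_of_deriv_eq_zero isPreconnected_Iio
          (fun r hr => (hwd r hr).differentiableWithinAt) (fun r hr => hv0 r hr) ht
          (show σ - 1 < σ by linarith)
      exact h0.of_subset_closure hwc continuousOn_const Iio_subset_Iic_self (by simp)
    have hσ : 0 < w σ := by
      rw [hconst σ self_mem_Iic]; exact hpos _ (by linarith)
    have hdσ : deriv w σ = 0 := by
      by_cases hd : DifferentiableAt ℝ w σ
      · have h2 : HasDerivWithinAt w 0 (Iic σ) σ :=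
          (hasDerivWithinAt_const σ (Iic σ) (w (σ - 1))).congr hconst (hconst σ self_mem_Iic)
        exact (uniqueDiffWithinAt_Iic σ).eq_deriv _ hd.hasDerivAt.hasDerivWithinAt h2
      · exact deriv_zero_of_not_differentiableAt hd
    rw [hdσ, zero_add] at hbc
    exact (mul_pos hβ hσ).ne' hbc
  intro t ht
  have ht : t < σ := ht
  have hlog : deriv (fun s => Real.log (w s)) =ᶠ[𝓝 t] fun s => deriv w s / w s := by
    filter_upwards [Iio_mem_nhds ht] with s hs
    exact ((hw' s hs).log (hpos s hs).ne').deriv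
  rw [hlog.deriv_eq, ((hv t ht).fun_div (hw' t ht) (hpos t ht).ne').deriv]
  refine div_neg_of_neg_of_pos ?_ (pow_pos (hpos t ht) 2)
  have := hermite_mul_deriv_deriv_sub_sq_neg hl hw' hpos hv hvlim
    (integrableOn_mul_exp_of_sq hwcont hvcont hw2 hv2) ht
  linarith
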